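/- arXiv:1404.7589 — 2 statements merged into one kernel-verified Lean document; each statement's English description precedes it below -/
import Mathlib

section
/- Let A be a finite dimensional self-injective k-algebra with Nakayama permutation σ (determined by Ae_i ≅ Hom_k(e_{σ(i)}A, k) as left A-modules). Then for any left A-module M there is a natural isomorphism Hom_A(Ae_i ⊗_k e_j A ⊗_A −, M) ≅ Hom_A(−, Ae_{σ^{-1}(j)} ⊗_k e_i A ⊗_A M); i.e., the functor Ae_{σ^{-1}(j)} ⊗_k e_i A ⊗_A − is right adjoint to Ae_i ⊗_k e_j A ⊗_A −. -/
set_option linter.unusedSectionVars false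

open TensorProduct

namespace Stmt14

variable (k : Type) [Field k] [IsAlgClosed k]
variable (A : Type) [Ring A] [Algebra k A]

instance smulCommSub (p : Submodule A A) : SMulCommClass k A ↥p :=
  ⟨fun c a x => Subtype.ext (smul_comm c a (x : A))⟩

instance smulCommSub' (p : Submodule A A) : SMulCommClass A k ↥p :=
  ⟨fun a c x => Subtype.ext (smul_comm c a (x : A)).symm⟩

/-- The left ideal `Ae`, as an `A`-submodule of `A`. -/
def lId (e : A) : Submodule A A := Submodule.span A {e}

/-- The action of `e ∈ A` on a left `A`-module `X`, as a `k`-linear endomorphism. -/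
def eAct (e : A) (X : Type) [AddCommGroup X] [Module A X] [Module k X]
    [IsScalarTower k A X] [SMulCommClass k A X] : X →ₗ[k] X where
  toFun x := e • x
  map_add' := smul_add e
  map_smul' c x := (smul_comm c e x).symm

/-- The `k`-subspace `eX` of a left `A`-module `X`; for `X = A` this is the right ideal
`eA`, and in general it is the canonical model of `eA ⊗_A X`. -/
def eSub (e : A) (X : Type) [AddCommGroup X] [Module A X] [Module k X]
    [IsScalarTower k A X] [SMulCommClass k A X] : Submodule k X :=
  LinearMap.range (eAct k A e X)

/-- Canonical model `Ae ⊗_k fX` of the module `Ae ⊗_k fA ⊗_A X`; it is a left `A`-module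
through the first tensor factor. -/
abbrev FF (e f : A) (X : Type) [AddCommGroup X] [Module A X] [Module k X]
    [IsScalarTower k A X] [SMulCommClass k A X] :=
  ↥(lId A e) ⊗[k] ↥(eSub k A f X)

lemma eSub_stable (f : A) {X X' : Type} [AddCommGroup X] [Module A X] [Module k X]
    [IsScalarTower k A X] [SMulCommClass k A X] [AddCommGroup X'] [Module A X']
    [Module k X'] [IsScalarTower k A X'] [SMulCommClass k A X'] (g : X →ₗ[A] X') :
    ∀ x ∈ eSub k A f X, (g.restrictScalars k) x ∈ eSub k A f X' := by
  rintro x ⟨y, rfl⟩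
  exact ⟨g y, by simp [eAct, eSub]⟩

/-- Functoriality of `X ↦ Ae ⊗_k fX` on morphisms, as an `A`-linear map. -/
noncomputable def Fmap (e f : A) {X X' : Type} [AddCommGroup X] [Module A X] [Module k X]
    [IsScalarTower k A X] [SMulCommClass k A X] [AddCommGroup X'] [Module A X']
    [Module k X'] [IsScalarTower k A X'] [SMulCommClass k A X'] (g : X →ₗ[A] X') :
    FF k A e f X →ₗ[A] FF k A e f X' :=
  TensorProduct.AlgebraTensorModule.map
    (LinearMap.id : ↥(lId A e) →ₗ[A] ↥(lId A e))
    ((g.restrictScalars k).restrict (eSub_stable k A f g))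

lemma eSubA_stable (f a : A) :
    ∀ x ∈ eSub k A f A, LinearMap.mulRight k a x ∈ eSub k A f A := by
  rintro x ⟨y, rfl⟩
  exact ⟨y * a, by simp [eAct, smul_eq_mul, mul_assoc]⟩

/-- Right multiplication by `a` on the right ideal `fA = eSub f A`. -/
def rApply (f a : A) : ↥(eSub k A f A) →ₗ[k] ↥(eSub k A f A) :=
  (LinearMap.mulRight k a).restrict (eSubA_stable k A f a)

/-- A primitive idempotent. -/
def IsPrimitiveIdempotent (e : A) : Prop :=
  IsIdempotentElem e ∧ e ≠ 0 ∧
    ∀ a b : A, IsIdempotentElem a → IsIdempotentElem b → a * b = 0 → b * a = 0 →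
      a + b = e → a = 0 ∨ b = 0

lemma lId_mul {e : A} (he : IsIdempotentElem e) (x : ↥(lId A e)) : (x : A) * e = x := by
  obtain ⟨x, hx⟩ := x
  obtain ⟨a, rfl⟩ := Submodule.mem_span_singleton.1 hx
  simp [mul_assoc, he.eq]

lemma eSub_smul {f : A} (hf : IsIdempotentElem f) {X : Type} [AddCommGroup X] [Module A X]
    [Module k X] [IsScalarTower k A X] [SMulCommClass k A X] (x : ↥(eSub k A f X)) :
    f • (x : X) = x := by
  obtain ⟨x, y, rfl⟩ := x
  change f • f • y = f • y
  rw [smul_smul, hf.eq]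

/-- The generator of `Ae`. -/
def lGen (e : A) : ↥(lId A e) := ⟨e, Submodule.mem_span_singleton_self e⟩

/-- The generator of `fA`. -/
def rGen (f : A) : ↥(eSub k A f A) := ⟨f, 1, by simp [eAct]⟩

/-- First half: `Hom_A(Ae ⊗ W, M) ≃ Hom_k(W, eM)`. -/
noncomputable def homEquivLeft {e : A} (he : IsIdempotentElem e)
    (W : Type) [AddCommGroup W] [Module k W]
    (M : Type) [AddCommGroup M] [Module A M] [Module k M] [IsScalarTower k A M]
    [SMulCommClass k A M] [SMulCommClass A k M] :
    ((↥(lId A e) ⊗[k] W) →ₗ[A] M) ≃ₗ[k] (W →ₗ[k] ↥(eSub k A e M)) where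
  toFun ψ :=
    { toFun := fun w => ⟨ψ (lGen A e ⊗ₜ w), ψ (lGen A e ⊗ₜ w), by
        change e • ψ (lGen A e ⊗ₜ w) = _
        rw [← map_smul, TensorProduct.smul_tmul']
        congr 2
        exact Subtype.ext he.eq⟩
      map_add' := fun v w => Subtype.ext (by simp [TensorProduct.tmul_add])
      map_smul' := fun c w => Subtype.ext (by
        change ψ (lGen A e ⊗ₜ (c • w)) = c • ψ (lGen A e ⊗ₜ w)
        rw [TensorProduct.tmul_smul, ← algebraMap_smul A c (lGen A e ⊗ₜ[k] w), map_smul,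
          algebraMap_smul]) }
  map_add' ψ ψ' := by ext w; rfl
  map_smul' c ψ := by ext w; rfl
  invFun φ := TensorProduct.AlgebraTensorModule.lift
    { toFun := fun a =>
        { toFun := fun w => (a : A) • (φ w : M)
          map_add' := fun v w => by simp
          map_smul' := fun c w => by
            rw [map_smul, Submodule.coe_smul, smul_comm]; rfl }
      map_add' := fun a b => by ext w; simp [add_smul]
      map_smul' := fun c a => by ext w; simp [mul_smul] }
  left_inv ψ := by
    apply TensorProduct.AlgebraTensorModule.ext
    intro x w
    change (x : A) • ψ (lGen A e ⊗ₜ w) = ψ (x ⊗ₜ w)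
    rw [← map_smul, TensorProduct.smul_tmul']
    congr 2
    exact Subtype.ext (lId_mul A he x)
  right_inv φ := by
    ext w
    exact eSub_smul k A he (φ w)

lemma homEquivLeft_apply {e : A} (he : IsIdempotentElem e)
    (W : Type) [AddCommGroup W] [Module k W]
    (M : Type) [AddCommGroup M] [Module A M] [Module k M] [IsScalarTower k A M]
    [SMulCommClass k A M] [SMulCommClass A k M] (ψ : (↥(lId A e) ⊗[k] W) →ₗ[A] M) (w : W) :
    (homEquivLeft k A he W M ψ w : M) = ψ (lGen A e ⊗ₜ w) := rfl

/-- `Ae ⊗ V ≃ Hom_k(fA, V)` from `Ae ≃ Hom_k(fA, k)`. -/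
noncomputable def tEquiv [FiniteDimensional k A] {e f : A}
    (Ψ : ↥(lId A e) ≃ₗ[k] (↥(eSub k A f A) →ₗ[k] k))
    (V : Type) [AddCommGroup V] [Module k V] :
    (↥(lId A e) ⊗[k] V) ≃ₗ[k] (↥(eSub k A f A) →ₗ[k] V) :=
  (TensorProduct.congr Ψ (LinearEquiv.refl k V)).trans
    (dualTensorHomEquiv k (↥(eSub k A f A)) V)

lemma tEquiv_tmul [FiniteDimensional k A] {e f : A}
    (Ψ : ↥(lId A e) ≃ₗ[k] (↥(eSub k A f A) →ₗ[k] k))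
    (V : Type) [AddCommGroup V] [Module k V] (x : ↥(lId A e)) (v : V)
    (y : ↥(eSub k A f A)) : tEquiv k A Ψ V (x ⊗ₜ v) y = Ψ x y • v := by
  simp [tEquiv]

lemma tEquiv_smul [FiniteDimensional k A] {e f : A}
    (Ψ : ↥(lId A e) ≃ₗ[k] (↥(eSub k A f A) →ₗ[k] k))
    (hΨ : ∀ (a : A) (x : ↥(lId A e)) (y : ↥(eSub k A f A)),
        Ψ (a • x) y = Ψ x (rApply k A f a y))
    (V : Type) [AddCommGroup V] [Module k V] (a : A) (t : ↥(lId A e) ⊗[k] V)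
    (y : ↥(eSub k A f A)) :
    tEquiv k A Ψ V (a • t) y = tEquiv k A Ψ V t (rApply k A f a y) := by
  induction t using TensorProduct.induction_on with
  | zero => simp
  | tmul x v => rw [TensorProduct.smul_tmul', tEquiv_tmul, tEquiv_tmul, hΨ]
  | add s t hs ht => rw [smul_add, map_add, map_add, LinearMap.add_apply, hs, ht]; rfl

/-- Action `fA → fX`, `y ↦ y x`. -/
def actR (f : A) {X : Type} [AddCommGroup X] [Module A X]
    [Module k X] [IsScalarTower k A X] [SMulCommClass k A X] (x : X) :
    ↥(eSub k A f A) →ₗ[k] ↥(eSub k A f X) where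
  toFun y := ⟨(y : A) • x, by
    obtain ⟨y, z, rfl⟩ := y
    exact ⟨z • x, by simp [eAct, mul_smul]⟩⟩
  map_add' y z := Subtype.ext (add_smul _ _ _)
  map_smul' c y := Subtype.ext (smul_assoc _ _ _)

/-- Second half: `Hom_A(X, Ae ⊗ V) ≃ Hom_k(fX, V)`. -/
noncomputable def homEquivRight [FiniteDimensional k A] {e f : A} (hf : IsIdempotentElem f)
    (Ψ : ↥(lId A e) ≃ₗ[k] (↥(eSub k A f A) →ₗ[k] k))
    (hΨ : ∀ (a : A) (x : ↥(lId A e)) (y : ↥(eSub k A f A)),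
        Ψ (a • x) y = Ψ x (rApply k A f a y))
    (V : Type) [AddCommGroup V] [Module k V]
    (X : Type) [AddCommGroup X] [Module A X]
    [Module k X] [IsScalarTower k A X] [SMulCommClass k A X] :
    (X →ₗ[A] (↥(lId A e) ⊗[k] V)) ≃ₗ[k] (↥(eSub k A f X) →ₗ[k] V) where
  toFun h :=
    { toFun := fun x => tEquiv k A Ψ V (h x) (rGen k A f)
      map_add' := fun x y => by simp
      map_smul' := fun c x => by
        have : h ((c • x : ↥(eSub k A f X)) : X) = c • h x := by
          rw [Submodule.coe_smul, ← algebraMap_smul A c (x : X), map_smul, algebraMap_smul]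
        rw [this]; simp }
  map_add' h h' := by ext x; simp
  map_smul' c h := by ext x; simp
  invFun φ :=
    { toFun := fun x => (tEquiv k A Ψ V).symm (φ ∘ₗ actR k A f x)
      map_add' := fun x y => by
        rw [← map_add]; congr 1; ext z
        simp only [LinearMap.comp_apply, LinearMap.add_apply, ← map_add]
        congr 1
        exact Subtype.ext (smul_add _ _ _)
      map_smul' := fun a x => by
        rw [LinearEquiv.symm_apply_eq]
        ext y
        rw [RingHom.id_apply, tEquiv_smul k A Ψ hΨ, LinearEquiv.apply_symm_apply]
        simp only [LinearMap.comp_apply]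
        congr 1
        exact Subtype.ext (smul_smul _ _ _) }
  left_inv h := by
    ext x
    change (tEquiv k A Ψ V).symm _ = _
    rw [LinearEquiv.symm_apply_eq]
    ext y
    change tEquiv k A Ψ V (h ((y : A) • x)) (rGen k A f) = _
    rw [map_smul, tEquiv_smul k A Ψ hΨ]
    congr 1
    exact Subtype.ext (eSub_smul k A hf y)
  right_inv φ := by
    ext x
    change tEquiv k A Ψ V ((tEquiv k A Ψ V).symm _) (rGen k A f) = _
    rw [LinearEquiv.apply_symm_apply]
    change φ _ = φ x
    congr 1
    exact Subtype.ext (eSub_smul k A hf x)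

lemma homEquivRight_apply [FiniteDimensional k A] {e f : A} (hf : IsIdempotentElem f)
    (Ψ : ↥(lId A e) ≃ₗ[k] (↥(eSub k A f A) →ₗ[k] k))
    (hΨ : ∀ (a : A) (x : ↥(lId A e)) (y : ↥(eSub k A f A)),
        Ψ (a • x) y = Ψ x (rApply k A f a y))
    (V : Type) [AddCommGroup V] [Module k V]
    (X : Type) [AddCommGroup X] [Module A X]
    [Module k X] [IsScalarTower k A X] [SMulCommClass k A X]
    (h : X →ₗ[A] (↥(lId A e) ⊗[k] V)) (x : ↥(eSub k A f X)) :
    homEquivRight k A hf Ψ hΨ V X h x = tEquiv k A Ψ V (h x) (rGen k A f) := rfl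

/-- Let `A` be a basic finite dimensional self-injective `k`-algebra with a complete set
`e 0, …, e (n-1)` of primitive orthogonal idempotents and Nakayama permutation `σ`,
determined by `A eᵢ ≅ Hom_k(e_{σ i} A, k)` as left `A`-modules (the left action on the
dual of the right module `e_{σ i}A` being `(a·φ)(x) = φ(x·a)`). Then, for all `i`, `j` and
every left `A`-module `M`, there is an isomorphism, natural in the `A`-module variable
`X`, of `Hom_A(A eᵢ ⊗_k eⱼA ⊗_A X, M)` with `Hom_A(X, A e_{σ⁻¹ j} ⊗_k eᵢA ⊗_A M)`; i.e.
the functor `A e_{σ⁻¹ j} ⊗_k eᵢ A ⊗_A -` is right adjoint to `A eᵢ ⊗_k eⱼ A ⊗_A -`.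
(Here `A e ⊗_k f A ⊗_A X` is realized via its canonical model `A e ⊗_k (f X)`.) -/
theorem stmt14 [FiniteDimensional k A]
    (hselfinj : Module.Injective A A)
    (n : ℕ) (e : Fin n → A)
    (hidem : ∀ i, IsPrimitiveIdempotent A (e i))
    (horth : ∀ i j, i ≠ j → e i * e j = 0)
    (hsum : ∑ i, e i = 1)
    (σ : Equiv.Perm (Fin n))
    (hNak : ∀ i, ∃ Ψ : ↥(lId A (e i)) ≃ₗ[k] (↥(eSub k A (e (σ i)) A) →ₗ[k] k),
      ∀ (a : A) (x : ↥(lId A (e i))) (y : ↥(eSub k A (e (σ i)) A)),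
        Ψ (a • x) y = Ψ x (rApply k A (e (σ i)) a y))
    (i j : Fin n)
    (M : Type) [AddCommGroup M] [Module A M] [Module k M] [IsScalarTower k A M]
    [SMulCommClass k A M] [SMulCommClass A k M] :
    ∃ Φ : ∀ (X : Type) [AddCommGroup X] [Module A X] [Module k X]
        [IsScalarTower k A X] [SMulCommClass k A X] [SMulCommClass A k X],
        (FF k A (e i) (e j) X →ₗ[A] M) ≃ₗ[k]
          (X →ₗ[A] FF k A (e (σ.symm j)) (e i) M),
      ∀ (X X' : Type) [AddCommGroup X] [Module A X] [Module k X]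
        [IsScalarTower k A X] [SMulCommClass k A X] [SMulCommClass A k X]
        [AddCommGroup X'] [Module A X'] [Module k X'] [IsScalarTower k A X']
        [SMulCommClass k A X'] [SMulCommClass A k X']
        (g : X →ₗ[A] X') (ψ : FF k A (e i) (e j) X' →ₗ[A] M),
        Φ X (ψ ∘ₗ Fmap k A (e i) (e j) g) = (Φ X' ψ) ∘ₗ g := by
  have hΨ' := hNak (σ.symm j)
  rw [Equiv.apply_symm_apply] at hΨ'
  obtain ⟨Ψ, hΨ⟩ := hΨ'
  refine ⟨fun X _ _ _ _ _ _ => (homEquivLeft k A (hidem i).1 (↥(eSub k A (e j) X)) M).trans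
    (homEquivRight k A (hidem j).1 Ψ hΨ (↥(eSub k A (e i) M)) X).symm, ?_⟩
  intro X X' _ _ _ _ _ _ _ _ _ _ _ _ g ψ
  rw [LinearEquiv.trans_apply, LinearEquiv.symm_apply_eq]
  ext x
  rw [homEquivRight_apply]
  have key := homEquivRight_apply k A (hidem j).1 Ψ hΨ (↥(eSub k A (e i) M)) X'
    ((homEquivRight k A (hidem j).1 Ψ hΨ (↥(eSub k A (e i) M)) X').symm
      (homEquivLeft k A (hidem i).1 (↥(eSub k A (e j) X')) M ψ))
    ⟨g x, eSub_stable k A (e j) g x x.2⟩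
  rw [LinearEquiv.apply_symm_apply] at key
  rw [LinearMap.comp_apply, LinearEquiv.trans_apply, ← key]
  rfl

end Stmt14
end

section
/- Let B be a finite dimensional algebra over an algebraically closed field k and G a right exact endofunctor of B-mod given by tensoring with a finite dimensional B-B-bimodule. If G is exact and G sends every simple B-module to a projective B-module, then the bimodule defining G is projective as a B-B-bimodule (i.e., G is a projective functor, a direct sum of functors Be ⊗_k fB ⊗_B −). -/
set_option linter.unusedSectionVars false

open TensorProduct

namespace Stmt15

variable (k : Type) [Field k] [IsAlgClosed k]
variable (B : Type) [Ring B] [Algebra k B]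

/-- The left ideal `Be` as a `k`-subspace of `B`. -/
def Be (e : B) : Submodule k B := LinearMap.range (LinearMap.mulRight k e)

/-- The right ideal `fB` as a `k`-subspace of `B`. -/
def fB (f : B) : Submodule k B := LinearMap.range (LinearMap.mulLeft k f)

lemma Be_stable (a e : B) : ∀ x ∈ Be k B e, LinearMap.mulLeft k a x ∈ Be k B e := by
  rintro x ⟨b, rfl⟩
  exact ⟨a * b, by simp [mul_assoc]⟩

lemma fB_stable (b f : B) : ∀ x ∈ fB k B f, LinearMap.mulRight k b x ∈ fB k B f := by
  rintro x ⟨c, rfl⟩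
  exact ⟨c * b, by simp [mul_assoc]⟩

/-- Left multiplication by `a` on the projective `B`-`B`-bimodule `Be ⊗_k fB`. -/
noncomputable def lact (a e f : B) :
    (Be k B e ⊗[k] fB k B f) →ₗ[k] (Be k B e ⊗[k] fB k B f) :=
  TensorProduct.map ((LinearMap.mulLeft k a).restrict (Be_stable k B a e)) LinearMap.id

/-- Right multiplication by `b` on the projective `B`-`B`-bimodule `Be ⊗_k fB`. -/
noncomputable def ract (b e f : B) :
    (Be k B e ⊗[k] fB k B f) →ₗ[k] (Be k B e ⊗[k] fB k B f) :=
  TensorProduct.map LinearMap.id ((LinearMap.mulRight k b).restrict (fB_stable k B b f))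

/-- For a maximal left ideal `J ⊆ B`, the `B`-submodule `M·J` of a bimodule `M`, so that
`M ⊗_B (B/J) ≅ M/(M·J)`. -/
def MJ (M : Type) [AddCommGroup M] [Module B M] [Module Bᵐᵒᵖ M]
    (J : Submodule B B) : Submodule B M :=
  Submodule.span B {x : M | ∃ (m : M) (j : B), j ∈ J ∧ x = MulOpposite.op j • m}

lemma exists_idem_of_not_nilpotent [FiniteDimensional k B] (a : B) (ha : ¬ IsNilpotent a) :
    ∃ c : B, IsIdempotentElem (c * a) ∧ c * a ≠ 0 := by
  have hint : IsIntegral k a := Algebra.IsIntegral.isIntegral a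
  have hne : minpoly k a ≠ 0 := minpoly.ne_zero hint
  obtain ⟨q, hq, hnd⟩ :=
    Polynomial.exists_eq_pow_rootMultiplicity_mul_and_not_dvd (minpoly k a) hne 0
  set m := (minpoly k a).rootMultiplicity 0
  simp only [map_zero, sub_zero] at hq hnd
  have hcop : IsCoprime (Polynomial.X ^ (m + 1) : Polynomial k) q :=
    IsCoprime.pow_left ((Polynomial.prime_X.irreducible.coprime_iff_not_dvd).2 hnd)
  obtain ⟨s, t, hst⟩ := hcop
  have h0 : Polynomial.aeval a (minpoly k a) = 0 := minpoly.aeval k a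
  have key : Polynomial.aeval a (s * Polynomial.X ^ m) * a
      = Polynomial.aeval a (s * Polynomial.X ^ (m + 1)) := by
    simp [pow_succ, mul_assoc]
  refine ⟨Polynomial.aeval a (s * Polynomial.X ^ m), ?_, ?_⟩
  · rw [key, IsIdempotentElem, ← map_mul, ← sub_eq_zero, ← map_sub]
    have : s * Polynomial.X ^ (m + 1) * (s * Polynomial.X ^ (m + 1)) - s * Polynomial.X ^ (m + 1)
        = - (s * t * Polynomial.X) * minpoly k a := by
      have : s * Polynomial.X ^ (m + 1) = 1 - t * q := by rw [← hst]; ring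
      rw [hq]
      calc _ = s * Polynomial.X ^ (m + 1) * (s * Polynomial.X ^ (m + 1) - 1) := by ring
        _ = s * Polynomial.X ^ (m + 1) * (1 - t * q - 1) := by rw [this]
        _ = _ := by ring
    rw [this, map_mul, h0, mul_zero]
  · rw [key]
    intro h
    apply ha
    refine ⟨m, ?_⟩
    have h1 : Polynomial.aeval a (t * q) = 1 := by
      have := congrArg (Polynomial.aeval a) hst
      rwa [map_add, h, zero_add, map_one] at this
    have h2 : Polynomial.aeval a (Polynomial.X ^ m * (t * q)) = 0 := by
      rw [show Polynomial.X ^ m * (t * q) = t * minpoly k a by rw [hq]; ring, map_mul, h0, mul_zero]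
    rw [map_mul, h1, mul_one] at h2
    simpa using h2

lemma exists_idem [FiniteDimensional k B] (I : Ideal B) (h : ¬ I ≤ Ring.jacobson B) :
    ∃ e ∈ I, IsIdempotentElem e ∧ e ≠ 0 := by
  by_contra! hcon
  apply h
  have hnil : ∀ a ∈ I, IsNilpotent a := by
    intro a ha
    by_contra hna
    obtain ⟨c, hc, hc0⟩ := exists_idem_of_not_nilpotent k B a hna
    exact hc0 (hcon _ (I.mul_mem_left c ha) hc)
  intro x hx
  rw [← Ideal.jacobson_bot, Ideal.mem_jacobson_iff]
  intro y
  obtain ⟨z, hz⟩ := (IsNilpotent.isUnit_add_one (hnil _ (I.mul_mem_left y hx)))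
  refine ⟨↑z⁻¹, ?_⟩
  have : (↑z⁻¹ : B) * (y * x + 1) = 1 := by rw [← hz]; simp
  rw [mul_add, mul_one, ← mul_assoc] at this
  rw [this]; simp

lemma proj_summand [FiniteDimensional k B] (V : Type) [AddCommGroup V] [Module B V]
    [Module.Projective B V] [Module.Finite B V] [Nontrivial V] :
    ∃ (φ : V →ₗ[B] B) (p : V), IsIdempotentElem (φ p) ∧ φ p ≠ 0 := by
  have : ∃ φ : V →ₗ[B] B, ¬ LinearMap.range φ ≤ Ring.jacobson B := by
    by_contra! hcon
    obtain ⟨s, hs⟩ := (Module.projective_def'.1 (inferInstance : Module.Projective B V))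
    have hle : (⊤ : Submodule B V) ≤ Ring.jacobson B • ⊤ := by
      intro x _
      have hx : Finsupp.linearCombination B id (s x) = x := LinearMap.congr_fun hs x
      rw [← hx, Finsupp.linearCombination_apply]
      refine Submodule.sum_mem _ fun v _ => Submodule.smul_mem_smul ?_ trivial
      exact hcon (Finsupp.lapply v ∘ₗ s) ⟨x, rfl⟩
    have := Submodule.FG.eq_bot_of_le_jacobson_smul (Module.Finite.fg_top) hle
    exact top_ne_bot this
  obtain ⟨φ, hφ⟩ := this
  obtain ⟨e, ⟨p, rfl⟩, he, he0⟩ := exists_idem k B _ hφ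
  exact ⟨φ, p, he, he0⟩

lemma proj_decomp [FiniteDimensional k B] (N : ℕ) : ∀ (V : Type) [AddCommGroup V] [Module B V]
    [Module k V] [IsScalarTower k B V] [FiniteDimensional k V]
    [Module.Projective B V], Module.finrank k V ≤ N → 
    ∃ (ι : Type) (_ : Fintype ι) (e : ι → B), (∀ i, IsIdempotentElem (e i)) ∧
      ∃ Φ : V ≃ₗ[k] ∀ i, Be k B (e i), ∀ (b : B) (v : V) i,
        (Φ (b • v) i : B) = b * (Φ v i : B) := by
  induction N with
  | zero =>
    intro V _ _ _ _ _ _ hN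
    have : Subsingleton V := Module.finrank_zero_iff.1 (Nat.le_zero.1 hN)
    refine ⟨Empty, inferInstance, Empty.elim, nofun, ?_⟩
    exact ⟨0, fun b v i => i.elim⟩
  | succ N ih =>
    intro V _ _ _ _ _ _ hN
    rcases subsingleton_or_nontrivial V with hV | hV
    · exact ih V (by rw [Module.finrank_zero_of_subsingleton]; simp)
    have : Module.Finite B V := Module.Finite.of_restrictScalars_finite k B V
    obtain ⟨φ, p, he, he0⟩ := proj_summand k B V
    set e := φ p with hedef
    let g : V →ₗ[B] B := (LinearMap.toSpanSingleton B B e) ∘ₗ φ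
    have hg : ∀ v, g v = φ v * e := fun v => rfl
    have hge : ∀ v, g v * e = g v := fun v => by rw [hg, mul_assoc, he.eq]
    have hgp : ∀ x : B, g (x • p) = x * e := fun x => by
      rw [hg, map_smul, smul_eq_mul, mul_assoc, ← hedef, he.eq]
    let r : V →ₗ[B] LinearMap.ker g :=
      LinearMap.codRestrict _ (LinearMap.id - (LinearMap.toSpanSingleton B V p) ∘ₗ g) (by
        intro v
        simp [LinearMap.mem_ker, hgp, hge])
    have hr : ∀ v, (r v : V) = v - g v • p := fun v => rfl
    have hproj : Module.Projective B (LinearMap.ker g) := by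
      refine Module.Projective.of_split (LinearMap.ker g).subtype r ?_
      ext v
      have : g v = 0 := v.2
      simp [hr, this]
    let K := (LinearMap.ker g)
    have hfin : FiniteDimensional k K :=
      inferInstanceAs (FiniteDimensional k (K.restrictScalars k))
    have hlt : Module.finrank k K < Module.finrank k V := by
      have : K.restrictScalars k < ⊤ := by
        rw [lt_top_iff_ne_top]
        intro h
        have : p ∈ K.restrictScalars k := h ▸ trivial
        have h2 : g p = 0 := this
        rw [hg, ← hedef, he.eq] at h2
        exact he0 h2
      exact Submodule.finrank_lt this.ne
    obtain ⟨ι, _, e', he', Φ, hΦ⟩ := ih K (by omega)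
    have hmem : ∀ v, g v ∈ Be k B e := fun v => ⟨φ v, rfl⟩
    let Ψ : V ≃ₗ[k] (Be k B e) × K := 
      { toFun := fun v => (⟨g v, hmem v⟩, r v)
        map_add' := by intro x y; ext <;> simp
        map_smul' := by
          intro c x
          ext
          · simp [LinearMap.map_smul_of_tower]
          · simp [LinearMap.map_smul_of_tower]
        invFun := fun x => (x.1 : B) • p + (x.2 : V)
        left_inv := by intro v; simp [hr]
        right_inv := by
          rintro ⟨⟨x, b, hb⟩, y⟩
          have h1 : x * e = x := by rw [← hb]; simp [mul_assoc, he.eq]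
          have h2 : g y = 0 := y.2
          ext
          · simp [hgp, h1, h2]
          · change (r (x • p + (y : V)) : V) = y
            rw [hr, map_add, hgp, h1, h2]; simp }
    refine ⟨Option ι, inferInstance, fun o => o.elim e e', ?_, ?_⟩
    · rintro (_ | i)
      · exact he
      · exact he' i
    let Θ : (Be k B e × ∀ i, Be k B (e' i)) ≃ₗ[k] 
        ∀ o : Option ι, Be k B (Option.elim o e e') :=
      (LinearEquiv.piOptionEquivProd (M := fun o => Be k B (Option.elim o e e')) k).symm
    refine ⟨Ψ.trans ((LinearEquiv.prodCongr (LinearEquiv.refl k _) Φ).trans Θ), ?_⟩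
    rintro b v (_ | i)
    · change g (b • v) = b * g v
      simp
    · change ((Φ (r (b • v)) i : Be k B (e' i)) : B) = b * (Φ (r v) i : Be k B (e' i))
      rw [map_smul, hΦ]

lemma wedd [FiniteDimensional k B] :
    ∃ (n : ℕ) (d : Fin n → ℕ) (f : Fin n → B) (u a : ∀ i, Fin (d i) → B),
      (∀ i, IsIdempotentElem (f i)) ∧
      (∀ i c, f i * u i c = u i c) ∧
      (1 - ∑ i, ∑ c, a i c * u i c ∈ Ring.jacobson B) ∧
      (∀ i c, u i c * a i c - f i ∈ Ring.jacobson B) ∧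
      (∀ i c c', c ≠ c' → u i c * a i c' ∈ Ring.jacobson B) ∧
      (∀ i j c c', i ≠ j → u i c * a j c' ∈ Ring.jacobson B) ∧
      (∀ i x, ∃ l : Fin (d i) → k, f i * x - ∑ c, l c • u i c ∈ Ring.jacobson B) ∧
      (∀ i b, b * f i ∉ Ring.jacobson B → ∃ b', b' * (b * f i) - f i ∈ Ring.jacobson B) ∧
      (∀ i, f i ∉ Ring.jacobson B) := by
  have hart := IsArtinianRing.of_finite k B
  obtain ⟨n, d, hd, ⟨E⟩⟩ :=
    IsSemisimpleRing.exists_algEquiv_pi_matrix_of_isAlgClosed k (B ⧸ Ring.jacobson B)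
  let π : B →ₐ[k] (Π i, Matrix (Fin (d i)) (Fin (d i)) k) :=
    E.toAlgHom.comp (Ideal.Quotient.mkₐ k (Ring.jacobson B))
  have hsurj : Function.Surjective π :=
    E.surjective.comp (Ideal.Quotient.mkₐ_surjective k _)
  have hker : ∀ b, b ∈ Ring.jacobson B ↔ π b = 0 := by
    intro b
    change _ ↔ E (Ideal.Quotient.mk _ b) = 0
    rw [map_eq_zero_iff E E.injective, Ideal.Quotient.eq_zero_iff_mem]
  clear_value π
  have hnil : ∀ x ∈ RingHom.ker π.toRingHom, IsNilpotent x := by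
    intro x hx
    have hx' : x ∈ Ring.jacobson B := (hker x).2 hx
    obtain ⟨m, hm⟩ := IsSemiprimaryRing.isNilpotent (R := B)
    refine ⟨m, ?_⟩
    have := Ideal.pow_mem_pow hx' m
    rw [hm] at this
    simpa using this
  let S : ∀ i, Fin (d i) → Fin (d i) → (Π i, Matrix (Fin (d i)) (Fin (d i)) k) :=
    fun i a b => Pi.single i (Matrix.single a b 1)
  have hSS : ∀ i a b c, S i a b * S i b c = S i a c := by
    intro i a b c
    simp [S, ← Pi.single_mul]
  have hSS' : ∀ i a b b' c, b ≠ b' → S i a b * S i b' c = 0 := by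
    intro i a b b' c h
    simp only [S, ← Pi.single_mul]
    rw [Matrix.single_mul_single_of_ne (h := h)]
    simp
  have hSS2 : ∀ i j a b b' c, i ≠ j → S i a b * S j b' c = 0 := by
    intro i j a b b' c h
    funext l
    by_cases hl : l = i
    · subst hl
      simp [S, h]
    · simp [S, hl]
  have hex : ∀ i, ∃ f : B, IsIdempotentElem f ∧ π f = S i 0 0 := by
    intro i
    refine exists_isIdempotentElem_eq_of_ker_isNilpotent π.toRingHom hnil _ (hsurj _) ?_
    exact hSS i 0 0 0
  choose f hf hπf using hex
  choose lift hlift using hsurj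
  refine ⟨n, d, f, fun i c => f i * lift (S i 0 c), fun i c => lift (S i c 0), hf, ?_, ?_, ?_, ?_,
    ?_, ?_, ?_, ?_⟩
  · intro i c
    rw [← mul_assoc, (hf i).eq]
  · rw [hker]
    simp only [map_sub, map_sum, map_mul, hlift, hπf, hSS, map_one]
    rw [sub_eq_zero]
    funext i
    rw [Finset.sum_apply, Finset.sum_eq_single i]
    · rw [Finset.sum_apply]
      simp [S, Matrix.sum_single_one]
    · intro j _ hj
      rw [Finset.sum_apply]
      simp [S, hj.symm]
    · simp
  · intro i c
    rw [hker]
    simp only [map_sub, map_mul, hlift, hπf, hSS, sub_self]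
  · intro i c c' h
    rw [hker]
    simp only [map_mul, hlift, hπf, hSS]
    exact hSS' _ _ _ _ _ h
  · intro i j c c' h
    rw [hker]
    simp only [map_mul, hlift, hπf, hSS]
    exact hSS2 _ _ _ _ _ _ h
  · intro i x
    refine ⟨fun c => π x i 0 c, ?_⟩
    rw [hker]
    simp only [map_sub, map_sum, map_smul, map_mul, hlift, hπf, hSS, sub_eq_zero]
    funext j
    by_cases hj : j = i
    · subst hj
      rw [Finset.sum_apply]
      simp only [S, Pi.mul_apply, Pi.single_eq_same, Pi.smul_apply]
      ext a b
      rw [Matrix.sum_apply]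
      by_cases ha : 0 = a
      · subst ha
        simp [Matrix.single_apply]
      · rw [Matrix.single_mul_apply_of_ne (h := Ne.symm ha)]
        simp [ha]
    · rw [Finset.sum_apply]
      simp [S, hj]
  · intro i b hb
    rw [hker, map_mul, hπf] at hb
    have : ∃ c, π b i c 0 ≠ 0 := by
      by_contra! hcon
      apply hb
      funext j
      by_cases hj : j = i
      · subst hj
        ext a c
        by_cases hc : c = 0
        · subst hc
          simp [S, hcon]
        · simp [S, hc]
      · simp [S, hj]
    obtain ⟨c, hc⟩ := this
    refine ⟨(π b i c 0)⁻¹ • lift (S i 0 c), ?_⟩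
    rw [hker]
    simp only [map_sub, map_smul, map_mul, hlift, hπf, sub_eq_zero]
    funext j
    by_cases hj : j = i
    · subst hj
      ext a' c'
      by_cases ha : a' = 0
      · subst ha
        by_cases hc' : c' = 0
        · subst hc'
          simp [S, hc]
        · simp [S, hc', Ne.symm hc']
      · simp [S, ha, Ne.symm ha]
    · simp [S, hj]
  · intro i h
    rw [hker, hπf] at h
    have := congrFun (congrFun (congrFun h i) 0) 0
    simp [S] at this

open MulOpposite in
/-- The subgroup `X·rad(B)` of a right `B`-module `X`. -/
def XR (X : Type) [AddCommGroup X] [Module Bᵐᵒᵖ X] : AddSubgroup X :=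
  AddSubgroup.closure {y | ∃ r ∈ Ring.jacobson B, ∃ x : X, y = op r • x}

open MulOpposite

variable {B} in
lemma XR_mem {X : Type} [AddCommGroup X] [Module Bᵐᵒᵖ X] {r : B} (hr : r ∈ Ring.jacobson B)
    (x : X) : op r • x ∈ XR B X :=
  AddSubgroup.subset_closure ⟨r, hr, x, rfl⟩

lemma XR_map {X Y : Type} [AddCommGroup X] [Module Bᵐᵒᵖ X] [AddCommGroup Y] [Module Bᵐᵒᵖ Y]
    (g : X →+ Y) (hg : ∀ r ∈ Ring.jacobson B, ∀ x, g (op r • x) ∈ XR B Y)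
    {x : X} (hx : x ∈ XR B X) : g x ∈ XR B Y := by
  have : XR B X ≤ (XR B Y).comap g := by
    unfold XR
    rw [AddSubgroup.closure_le]
    rintro _ ⟨r, hr, x, rfl⟩
    exact hg r hr x
  exact this hx

lemma XR_maplin {X Y : Type} [AddCommGroup X] [Module Bᵐᵒᵖ X] [AddCommGroup Y] [Module Bᵐᵒᵖ Y]
    (g : X →ₗ[Bᵐᵒᵖ] Y) {x : X} (hx : x ∈ XR B X) : g x ∈ XR B Y :=
  XR_map B g.toAddMonoidHom (fun r hr x => by
    change g _ ∈ _
    rw [map_smul]; exact XR_mem hr _) hx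

lemma XR_op_smul {X : Type} [AddCommGroup X] [Module Bᵐᵒᵖ X] (b : B) {x : X}
    (hx : x ∈ XR B X) : op b • x ∈ XR B X :=
  XR_map B (DistribSMul.toAddMonoidHom X (op b)) (fun r hr x => by
    change op b • op r • x ∈ _
    rw [smul_smul, ← op_mul]
    exact XR_mem (Ideal.mul_mem_right _ _ hr) _) hx

lemma XR_smul {X : Type} [AddCommGroup X] [Module Bᵐᵒᵖ X] [Module B X] [SMulCommClass B Bᵐᵒᵖ X]
    (b : B) {x : X} (hx : x ∈ XR B X) : b • x ∈ XR B X :=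
  XR_map B (DistribSMul.toAddMonoidHom X b) (fun r hr x => by
    change b • op r • x ∈ _
    rw [smul_comm]
    exact XR_mem hr _) hx

lemma nak [FiniteDimensional k B] {X : Type} [AddCommGroup X] [Module Bᵐᵒᵖ X]
    (hX : ∀ x : X, x ∈ XR B X) (x : X) : x = 0 := by
  have hart := IsArtinianRing.of_finite k B
  obtain ⟨m, hm⟩ := IsSemiprimaryRing.isNilpotent (R := B)
  have key : ∀ n : ℕ, ∀ x : X, x ∈
      AddSubgroup.closure {y | ∃ r ∈ Ring.jacobson B ^ n, ∃ x : X, y = op r • x} := by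
    intro n
    induction n with
    | zero =>
      intro x
      exact AddSubgroup.subset_closure ⟨1, by rw [Submodule.pow_zero, Ideal.one_eq_top]; trivial, x, by simp⟩
    | succ n ih =>
      intro x
      refine AddSubgroup.closure_induction ?_ (zero_mem _) (fun _ _ _ _ => add_mem)
        (fun _ _ => neg_mem) (ih x)
      rintro _ ⟨r, hr, y, rfl⟩
      refine AddSubgroup.closure_induction (p := fun y _ => op r • y ∈ _) ?_ ?_ ?_ ?_ (hX y)
      · rintro _ ⟨s, hs, z, rfl⟩
        refine AddSubgroup.subset_closure ⟨s * r, ?_, z, ?_⟩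
        · rw [Ideal.IsTwoSided.pow_succ]
          exact Ideal.mul_mem_mul hs hr
        · rw [smul_smul, ← op_mul]
      · rw [smul_zero]; exact zero_mem _
      · intro a b _ _ ha hb
        rw [smul_add]; exact add_mem ha hb
      · intro a _ ha
        rw [smul_neg]; exact neg_mem ha
  have h := key m x
  rw [hm] at h
  refine AddSubgroup.closure_induction (p := fun y _ => y = 0) ?_ rfl ?_ ?_ h
  · rintro _ ⟨r, hr, y, rfl⟩
    have : r = 0 := by simpa using hr
    simp [this]
  · rintro a b _ _ rfl rfl; simp
  · rintro a _ rfl; simp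

lemma inj_of_mod_rad [FiniteDimensional k B] {X M : Type} [AddCommGroup X] [Module Bᵐᵒᵖ X]
    [AddCommGroup M] [Module Bᵐᵒᵖ M] (hproj : Module.Projective Bᵐᵒᵖ M)
    (Ψ : X →ₗ[Bᵐᵒᵖ] M) (hsurj : Function.Surjective Ψ) (h : ∀ x, Ψ x = 0 → x ∈ XR B X) :
    Function.Injective Ψ := by
  obtain ⟨s, hs⟩ := Module.projective_lifting_property Ψ LinearMap.id hsurj
  have hs' : ∀ m, Ψ (s m) = m := fun m => LinearMap.congr_fun hs m
  let pr : X →ₗ[Bᵐᵒᵖ] LinearMap.ker Ψ :=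
    LinearMap.codRestrict _ (LinearMap.id - s ∘ₗ Ψ) (by
      intro x; simp [LinearMap.mem_ker, hs'])
  have hpr : ∀ x : LinearMap.ker Ψ, pr x = x := by
    intro x
    apply Subtype.ext
    have : Ψ x = 0 := x.2
    simp [pr, this]
  have hK : ∀ x : LinearMap.ker Ψ, x = 0 := by
    refine nak k B ?_
    intro x
    rw [← hpr x]
    exact XR_maplin B pr (h _ x.2)
  rw [← LinearMap.ker_eq_bot, Submodule.eq_bot_iff]
  intro x hx
  exact congrArg Subtype.val (hK ⟨x, hx⟩)

/-- `fB` as a right module. -/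
def Fr (f : B) : Submodule Bᵐᵒᵖ B where
  carrier := fB k B f
  add_mem' := fun ha hb => add_mem ha hb
  zero_mem' := zero_mem _
  smul_mem' := by
    rintro b x hx
    exact fB_stable k B b.unop f x hx

lemma core [FiniteDimensional k B]
    (M : Type) [AddCommGroup M] [Module B M] [Module Bᵐᵒᵖ M]
    [SMulCommClass B Bᵐᵒᵖ M] [Module k M] [IsScalarTower k B M]
    [IsScalarTower k Bᵐᵒᵖ M]
    (hproj : Module.Projective Bᵐᵒᵖ M)
    (n : ℕ) (d : Fin n → ℕ) (f : Fin n → B) (u a : ∀ i, Fin (d i) → B)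
    (hf : ∀ i, IsIdempotentElem (f i))
    (hfu : ∀ i c, f i * u i c = u i c)
    (hone : 1 - ∑ i, ∑ c, a i c * u i c ∈ Ring.jacobson B)
    (hua : ∀ i c, u i c * a i c - f i ∈ Ring.jacobson B)
    (hua1 : ∀ i c c', c ≠ c' → u i c * a i c' ∈ Ring.jacobson B)
    (hua2 : ∀ i j c c', i ≠ j → u i c * a j c' ∈ Ring.jacobson B)
    (hspan : ∀ i x, ∃ l : Fin (d i) → k, f i * x - ∑ c, l c • u i c ∈ Ring.jacobson B)
    (V : Fin n → Type) [∀ i, AddCommGroup (V i)] [∀ i, Module B (V i)] [∀ i, Module k (V i)]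
    [∀ i, IsScalarTower k B (V i)]
    (σ : ∀ i, V i →ₗ[B] M)
    (hS : ∀ i m, ∃ v, ∀ x, f i * x = x → op x • m - op x • σ i v ∈ XR B M)
    (hI : ∀ i v, op (f i) • σ i v ∈ XR B M → v = 0) :
    ∃ Ψ : (∀ i, Fr k B (f i) ⊗[k] V i) →ₗ[Bᵐᵒᵖ] M, Function.Bijective Ψ ∧
      ∀ i x v, Ψ (Pi.single i (x ⊗ₜ v)) = op (x : B) • σ i v := by
  classical
  let ψ : ∀ i, Fr k B (f i) ⊗[k] V i →ₗ[Bᵐᵒᵖ] M := fun i =>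
    AlgebraTensorModule.lift
      { toFun := fun x =>
          { toFun := fun v => op (x : B) • σ i v
            map_add' := by intro v w; simp
            map_smul' := by
              intro c v
              rw [LinearMap.map_smul_of_tower, RingHom.id_apply]
              rw [← algebraMap_smul B c (σ i v), ← smul_comm, algebraMap_smul] }
        map_add' := by
          intro x y; ext v; simp [add_smul]
        map_smul' := by
          intro b x; ext v
          simp only [LinearMap.coe_mk, AddHom.coe_mk, RingHom.id_apply, LinearMap.smul_apply]
          rw [smul_smul]
          rfl }
  have hψ : ∀ i x v, ψ i (x ⊗ₜ v) = op (x : B) • σ i v := fun i x v => rfl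
  clear_value ψ
  let Ψ : (∀ i, Fr k B (f i) ⊗[k] V i) →ₗ[Bᵐᵒᵖ] M := ∑ i, ψ i ∘ₗ LinearMap.proj i
  have hΨ : ∀ x, Ψ x = ∑ i, ψ i (x i) := by intro x; simp [Ψ]
  have hΨ1 : ∀ i y, Ψ (Pi.single i y) = ψ i y := by
    intro i y
    rw [hΨ, Finset.sum_eq_single i]
    · simp
    · intro j _ hj; simp [hj]
    · simp
  clear_value Ψ
  have hum : ∀ i c, u i c ∈ Fr k B (f i) := fun i c => ⟨u i c, hfu i c⟩
  let U : ∀ i c, Fr k B (f i) := fun i c => ⟨u i c, hum i c⟩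
  have hfm : ∀ i, f i ∈ Fr k B (f i) := fun i => ⟨f i, hf i⟩
  have hFr : ∀ i (x : Fr k B (f i)), f i * (x : B) = x := by
    rintro i ⟨x, y, rfl⟩
    simp only [LinearMap.mulLeft_apply, ← mul_assoc, (hf i).eq]
  -- surjectivity
  have hsurj : Function.Surjective Ψ := by
    rw [← LinearMap.range_eq_top]
    set N := LinearMap.range Ψ
    have : ∀ x : M ⧸ N, x = 0 := by
      refine nak k B ?_
      intro x
      obtain ⟨m, rfl⟩ := N.mkQ_surjective x
      choose v hv using fun i c => hS i (op (a i c) • m)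
      have h1 : m - Ψ (∑ i, ∑ c, Pi.single i (U i c ⊗ₜ v i c)) ∈ XR B M := by
        have e1 : m - Ψ (∑ i, ∑ c, Pi.single i (U i c ⊗ₜ v i c)) =
            op (1 - ∑ i, ∑ c, a i c * u i c) • m + ∑ i, ∑ c, 
              (op (u i c) • op (a i c) • m - op (u i c) • σ i (v i c)) := by
          simp only [map_sum, hΨ1, hψ, U, Finset.sum_sub_distrib, smul_smul, ← op_mul, op_sub,
            Finset.op_sum, sub_smul, Finset.sum_smul, op_one, one_smul]
          abel
        rw [e1]
        refine add_mem (XR_mem hone m) (sum_mem fun i _ => sum_mem fun c _ => ?_)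
        exact hv i c _ (hfu i c)
      have h2 := XR_maplin B N.mkQ h1
      rw [map_sub] at h2
      have h3 : N.mkQ (Ψ (∑ i, ∑ c, Pi.single i (U i c ⊗ₜ v i c))) = 0 := by
        rw [Submodule.mkQ_apply, Submodule.Quotient.mk_eq_zero]
        exact ⟨_, rfl⟩
      rwa [h3, sub_zero] at h2
    rw [Submodule.eq_top_iff']
    intro m
    rw [← Submodule.Quotient.mk_eq_zero]
    exact this _
  -- normal form modulo the radical
  have hnf1 : ∀ i (y : Fr k B (f i) ⊗[k] V i), ∃ v : Fin (d i) → V i,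
      y - ∑ c, U i c ⊗ₜ v c ∈ XR B (Fr k B (f i) ⊗[k] V i) := by
    intro i y
    induction y using TensorProduct.induction_on with
    | zero => exact ⟨0, by simp [zero_mem]⟩
    | add y z hy hz =>
      obtain ⟨v, hv⟩ := hy
      obtain ⟨w, hw⟩ := hz
      refine ⟨v + w, ?_⟩
      have := add_mem hv hw
      convert this using 1
      simp only [Pi.add_apply, tmul_add, Finset.sum_add_distrib]
      abel
    | tmul x v =>
      obtain ⟨l, hl⟩ := hspan i x
      refine ⟨fun c => l c • v, ?_⟩
      have e1 : (x ⊗ₜ v - ∑ c, U i c ⊗ₜ[k] (l c • v) : Fr k B (f i) ⊗[k] V i) =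
          op (f i * (x : B) - ∑ c, l c • u i c) • ((⟨f i, hfm i⟩ : Fr k B (f i)) ⊗ₜ v) := by
        rw [smul_tmul']
        simp only [tmul_smul, ← sum_tmul, ← sub_tmul, smul_tmul']
        congr 1
        apply Subtype.ext
        change _ = f i * (f i * (x : B) - ∑ c, l c • u i c)
        simp only [mul_sub, Finset.mul_sum, mul_smul_comm, hfu, hFr]
        simp [U]
      rw [e1]
      exact XR_mem hl _
  have hinj : Function.Injective Ψ := by
    refine inj_of_mod_rad k B (X := ∀ i, Fr k B (f i) ⊗[k] V i) hproj Ψ hsurj ?_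
    intro x hx
    choose v hv using fun i => hnf1 i (x i)
    let w : ∀ i, Fr k B (f i) ⊗[k] V i := fun i => x i - ∑ c, U i c ⊗ₜ v i c
    have hw : w ∈ XR B (∀ i, Fr k B (f i) ⊗[k] V i) := by
      have : w = ∑ i, LinearMap.single Bᵐᵒᵖ (fun i => Fr k B (f i) ⊗[k] V i) i (w i) := by
        simp only [LinearMap.single_apply]
        exact (Finset.univ_sum_single w).symm
      rw [this]
      exact sum_mem fun i _ => XR_maplin B _ (hv i)
    have hxw : x = w + ∑ i, ∑ c, Pi.single i (U i c ⊗ₜ v i c) := by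
      funext j
      rw [Pi.add_apply, Finset.sum_apply, Finset.sum_eq_single j]
      · rw [Finset.sum_apply]
        simp only [Pi.single_eq_same]
        exact (sub_add_cancel _ _).symm
      · intro i _ hi
        rw [Finset.sum_apply]
        simp [hi.symm]
      · simp
    have hx2 : ∑ i, ∑ c, op (u i c) • σ i (v i c) ∈ XR B M := by
      have h1 : Ψ w ∈ XR B M := XR_maplin B Ψ hw
      have h2 : Ψ w + ∑ i, ∑ c, op (u i c) • σ i (v i c) = 0 := by
        rw [← hx]
        conv_rhs => rw [hxw]
        rw [map_add]
        simp only [map_sum, hΨ1, hψ, U]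
      rw [← neg_eq_of_add_eq_zero_right h2]
      exact neg_mem h1
    have hv0 : ∀ j c', v j c' = 0 := by
      intro j c'
      apply hI
      have h3 := XR_op_smul B (a j c') hx2
      have h4 : op (a j c') • ∑ i, ∑ c, op (u i c) • σ i (v i c) - op (f j) • σ j (v j c') ∈
          XR B M := by
        have e1 : op (f j) • σ j (v j c') = ∑ i, ∑ c,
            if h : i = j then (if c = h ▸ c' then op (f j) • σ i (v i c) else 0) else 0 := by
          rw [Finset.sum_eq_single j, Finset.sum_eq_single c']
          · simp
          · intro c _ hc; simp [hc]
          · simp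
          · intro i _ hi; simp [hi]
          · simp
        rw [e1]
        simp only [Finset.smul_sum, ← Finset.sum_sub_distrib]
        refine sum_mem fun i _ => sum_mem fun c _ => ?_
        rw [smul_smul, ← op_mul]
        by_cases hij : i = j
        · subst hij
          by_cases hc : c = c'
          · subst hc
            simp only [dite_true, if_true]
            rw [← sub_smul, ← op_sub]
            exact XR_mem (hua i c) _
          · simp only [dite_true, if_neg hc, sub_zero]
            exact XR_mem (hua1 i c c' hc) _
        · simp only [hij, dite_false, sub_zero]
          exact XR_mem (hua2 i j c c' hij) _
      have := sub_mem h3 h4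
      rwa [sub_sub_cancel] at this
    have : x = w := by
      rw [hxw]; simp [hv0]
    rw [this]; exact hw
  refine ⟨Ψ, ⟨hinj, hsurj⟩, ?_⟩
  intro i x v
  rw [hΨ1, hψ]

/-- `fB` as right module and as subspace agree. -/
def frEquiv (f : B) : Fr k B f ≃ₗ[k] fB k B f where
  toFun x := ⟨x.1, x.2⟩
  invFun x := ⟨x.1, x.2⟩
  map_add' _ _ := rfl
  map_smul' _ _ := rfl
  left_inv _ := rfl
  right_inv _ := rfl

/-- Distributing the tensor product over a decomposition. -/
noncomputable def Theta (f : B) (V : Type) [AddCommGroup V] [Module k V]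
    {ι : Type} [Fintype ι] [DecidableEq ι] (e : ι → B) (Φ : V ≃ₗ[k] ∀ i, Be k B (e i)) :
    (Fr k B f ⊗[k] V) ≃ₗ[k] ∀ j, Be k B (e j) ⊗[k] fB k B f :=
  (TensorProduct.congr (frEquiv k B f) Φ).trans
    ((TensorProduct.piRight k k (fB k B f) (fun j => Be k B (e j))).trans
      (LinearEquiv.piCongrRight fun _ => TensorProduct.comm k _ _))

lemma Theta_tmul (f : B) (V : Type) [AddCommGroup V] [Module k V]
    {ι : Type} [Fintype ι] [DecidableEq ι] (e : ι → B) (Φ : V ≃ₗ[k] ∀ i, Be k B (e i))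
    (x : Fr k B f) (v : V) (j : ι) :
    Theta k B f V e Φ (x ⊗ₜ v) j = Φ v j ⊗ₜ frEquiv k B f x := by
  simp [Theta]

lemma Theta_left (f : B) (V : Type) [AddCommGroup V] [Module k V] [Module B V]
    [IsScalarTower k B V]
    {ι : Type} [Fintype ι] [DecidableEq ι] (e : ι → B) (Φ : V ≃ₗ[k] ∀ i, Be k B (e i))
    (hΦ : ∀ (b : B) (v : V) i, (Φ (b • v) i : B) = b * (Φ v i : B))
    (b : B) (y : Fr k B f ⊗[k] V) (j : ι) :
    Theta k B f V e Φ (TensorProduct.map LinearMap.id (Algebra.lsmul k k V b) y) j =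
      lact k B b (e j) f (Theta k B f V e Φ y j) := by
  induction y using TensorProduct.induction_on with
  | zero => simp
  | add y z hy hz => simp only [map_add, Pi.add_apply, hy, hz]
  | tmul x v =>
    rw [TensorProduct.map_tmul, Theta_tmul, Theta_tmul, lact, TensorProduct.map_tmul]
    congr 1
    apply Subtype.ext
    exact hΦ b v j

lemma Theta_right (f : B) (V : Type) [AddCommGroup V] [Module k V]
    {ι : Type} [Fintype ι] [DecidableEq ι] (e : ι → B) (Φ : V ≃ₗ[k] ∀ i, Be k B (e i))
    (b : B) (y : Fr k B f ⊗[k] V) (j : ι) :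
    Theta k B f V e Φ (op b • y) j =
      ract k B b (e j) f (Theta k B f V e Φ y j) := by
  induction y using TensorProduct.induction_on with
  | zero => simp
  | add y z hy hz => simp only [smul_add, map_add, Pi.add_apply, hy, hz]
  | tmul x v =>
    rw [smul_tmul', Theta_tmul, Theta_tmul, ract, TensorProduct.map_tmul]
    rfl

/-- The maximal left ideal attached to an idempotent. -/
def Jf (f : B) : Submodule B B := Submodule.comap (LinearMap.toSpanSingleton B B f) (Ring.jacobson B)

lemma mem_Jf (f b : B) : b ∈ Jf B f ↔ b * f ∈ Ring.jacobson B := Iff.rfl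

lemma Jf_coatom (f : B) (hf0 : f ∉ Ring.jacobson B)
    (h : ∀ b, b * f ∉ Ring.jacobson B → ∃ b', b' * (b * f) - f ∈ Ring.jacobson B) :
    IsCoatom (Jf B f) := by
  constructor
  · intro htop
    have : (1 : B) ∈ Jf B f := htop ▸ trivial
    rw [mem_Jf, one_mul] at this
    exact hf0 this
  · intro K hK
    obtain ⟨hle, b, hbK, hbJ⟩ := Set.ssubset_iff_exists.1 hK
    obtain ⟨b', hb'⟩ := h b hbJ
    have h1 : b' * b - 1 ∈ K := by
      apply hle
      change b' * b - 1 ∈ Jf B f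
      rw [mem_Jf, sub_mul, one_mul, mul_assoc]
      exact hb'
    have h2 : b' * b ∈ K := K.smul_mem b' hbK
    have h3 := sub_mem h2 h1
    rw [sub_sub_cancel] at h3
    exact (Ideal.eq_top_iff_one K).2 h3

set_option maxHeartbeats 2000000 in
/-- Let `B` be a finite dimensional algebra over an algebraically closed field `k` and `M`
a finite dimensional `B`-`B`-bimodule. If `M` is projective (equivalently flat) as a right
`B`-module — i.e. the functor `M ⊗_B -` is exact — and `M ⊗_B L ≅ M/(M·J)` is a
projective left `B`-module for every simple left `B`-module `L = B/J` (`J` a maximal left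
ideal), then `M` is a projective `B`-`B`-bimodule, i.e. `M` is isomorphic as a bimodule
to a direct sum of bimodules `Be ⊗_k fB` for idempotents `e`, `f`. -/
theorem stmt15 [FiniteDimensional k B]
    (M : Type) [AddCommGroup M] [Module B M] [Module Bᵐᵒᵖ M]
    [SMulCommClass B Bᵐᵒᵖ M] [Module k M] [IsScalarTower k B M]
    [IsScalarTower k Bᵐᵒᵖ M] [FiniteDimensional k M]
    (hproj : Module.Projective Bᵐᵒᵖ M)
    (hsimple : ∀ J : Submodule B B, IsCoatom J → Module.Projective B (M ⧸ MJ B M J)) :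
    ∃ (n : ℕ) (e f : Fin n → B),
      (∀ i, IsIdempotentElem (e i)) ∧ (∀ i, IsIdempotentElem (f i)) ∧
      ∃ Φ : M ≃ₗ[k] ∀ i, Be k B (e i) ⊗[k] fB k B (f i),
        (∀ (b : B) (m : M), Φ (b • m) = fun i => lact k B b (e i) (f i) (Φ m i)) ∧
        (∀ (b : B) (m : M),
          Φ (MulOpposite.op b • m) = fun i => ract k B b (e i) (f i) (Φ m i)) := by
  classical
  obtain ⟨n, d, f, u, a, hf, hfu, hone, hua, hua1, hua2, hspan, hmax, hf0⟩ := wedd k B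
  have hco : ∀ i, IsCoatom (Jf B (f i)) := fun i => Jf_coatom B (f i) (hf0 i) (hmax i)
  let V : Fin n → Type := fun i => M ⧸ MJ B M (Jf B (f i))
  have hPV : ∀ i, Module.Projective B (V i) := fun i => hsimple _ (hco i)
  have hsec : ∀ i, ∃ s : V i →ₗ[B] M, (MJ B M (Jf B (f i))).mkQ ∘ₗ s = LinearMap.id :=
    fun i => Module.projective_lifting_property _ _ (Submodule.mkQ_surjective _)
  choose σ hσ using hsec
  have hσ' : ∀ i v, (MJ B M (Jf B (f i))).mkQ (σ i v) = v := fun i v =>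
    LinearMap.congr_fun (hσ i) v
  have hMJ : ∀ i (x y : _), f i * x = x → y ∈ MJ B M (Jf B (f i)) →
      MulOpposite.op x • y ∈ XR B M := by
    intro i x y hx hy
    refine Submodule.span_induction (p := fun y _ => MulOpposite.op x • y ∈ XR B M)
      ?_ ?_ ?_ ?_ hy
    · rintro _ ⟨m, j, hj, rfl⟩
      rw [smul_smul, ← MulOpposite.op_mul]
      refine XR_mem ?_ _
      rw [← hx, ← mul_assoc]
      exact Ideal.mul_mem_right _ _ hj
    · rw [smul_zero]; exact zero_mem _
    · intro y z _ _ hy hz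
      rw [smul_add]; exact add_mem hy hz
    · intro b y _ hy
      rw [← smul_comm]; exact XR_smul B b hy
  have hXRle : ∀ i (y : M), y ∈ XR B M → y ∈ MJ B M (Jf B (f i)) := by
    intro i y hy
    refine AddSubgroup.closure_induction ?_ (zero_mem _) (fun _ _ _ _ => add_mem)
      (fun _ _ => neg_mem) hy
    rintro _ ⟨r, hr, m, rfl⟩
    refine Submodule.subset_span ⟨m, r, ?_, rfl⟩
    rw [mem_Jf]
    exact Ideal.mul_mem_right _ _ hr
  have hS : ∀ i m, ∃ v, ∀ x, f i * x = x →
      MulOpposite.op x • m - MulOpposite.op x • σ i v ∈ XR B M := by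
    intro i m
    refine ⟨(MJ B M (Jf B (f i))).mkQ m, fun x hx => ?_⟩
    rw [← smul_sub]
    refine hMJ i x _ hx ?_
    rw [← Submodule.Quotient.mk_eq_zero, ← Submodule.mkQ_apply, map_sub, hσ', sub_self]
  have hI : ∀ i v, MulOpposite.op (f i) • σ i v ∈ XR B M → v = 0 := by
    intro i v hv
    rw [← hσ' i v, Submodule.mkQ_apply, Submodule.Quotient.mk_eq_zero]
    have h1 := hXRle i _ hv
    have h2 : MulOpposite.op (1 - f i) • σ i v ∈ MJ B M (Jf B (f i)) := by
      refine Submodule.subset_span ⟨_, _, ?_, rfl⟩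
      rw [mem_Jf, sub_mul, one_mul, (hf i).eq, sub_self]
      exact zero_mem _
    have := add_mem h1 h2
    rwa [MulOpposite.op_sub, sub_smul, MulOpposite.op_one, one_smul, add_sub_cancel] at this
  obtain ⟨Ψ, hbij, hΨ⟩ := core k B M hproj n d f u a hf hfu hone hua hua1 hua2 hspan V σ hS hI
  have hfdV : ∀ i, FiniteDimensional k (V i) := fun i =>
    Module.Finite.of_surjective ((MJ B M (Jf B (f i))).mkQ.restrictScalars k)
      (Submodule.mkQ_surjective _)
  choose ι hι e he Φ hΦ using fun i => proj_decomp k B (Module.finrank k (V i)) (V i) le_rfl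
  let eq : Fin (Fintype.card (Σ i, ι i)) ≃ (Σ i, ι i) := (Fintype.equivFin _).symm
  let X : (Σ i, ι i) → Type := fun s => Be k B (e s.1 s.2) ⊗[k] fB k B (f s.1)
  let T : ∀ i, (Fr k B (f i) ⊗[k] V i) ≃ₗ[k] ∀ j, Be k B (e i j) ⊗[k] fB k B (f i) :=
    fun i => Theta k B (f i) (V i) (e i) (Φ i)
  let Ω : (∀ i, Fr k B (f i) ⊗[k] V i) ≃ₗ[k]
      ∀ t, Be k B (e (eq t).1 (eq t).2) ⊗[k] fB k B (f (eq t).1) :=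
    (LinearEquiv.piCongrRight T).trans
      ((LinearEquiv.piCurry k (fun i j => Be k B (e i j) ⊗[k] fB k B (f i))).symm.trans
        (LinearEquiv.piCongrLeft k X eq).symm)
  have hΩ : ∀ x t, Ω x t = T (eq t).1 (x (eq t).1) (eq t).2 := fun x t => rfl
  let ΨE : (∀ i, Fr k B (f i) ⊗[k] V i) ≃ₗ[k] M :=
    LinearEquiv.ofBijective (Ψ.restrictScalars k) hbij
  have hΨE : ∀ x, ΨE x = Ψ x := fun x => rfl
  have hL : ∀ (b : B) x, b • ΨE x =
      ΨE (fun i => TensorProduct.map LinearMap.id (Algebra.lsmul k k (V i) b) (x i)) := by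
    intro b
    suffices h : (Algebra.lsmul k k M b) ∘ₗ ΨE.toLinearMap = ΨE.toLinearMap ∘ₗ
        LinearMap.pi (fun i => TensorProduct.map LinearMap.id (Algebra.lsmul k k (V i) b) ∘ₗ
          LinearMap.proj i) from fun x => LinearMap.congr_fun h x
    refine LinearMap.pi_ext' fun i => TensorProduct.ext' fun x v => ?_
    change b • Ψ (Pi.single i (x ⊗ₜ v)) = Ψ (fun j => TensorProduct.map LinearMap.id
      (Algebra.lsmul k k (V j) b) ((Pi.single i (x ⊗ₜ v) : ∀ i, Fr k B (f i) ⊗[k] V i) j))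
    have : (fun j => TensorProduct.map LinearMap.id
        (Algebra.lsmul k k (V j) b) ((Pi.single i (x ⊗ₜ v) : ∀ i, Fr k B (f i) ⊗[k] V i) j)) =
        Pi.single i (x ⊗ₜ (b • v)) := by
      funext j
      by_cases hj : j = i
      · subst hj; simp
      · simp [hj]
    rw [this, hΨ, hΨ, map_smul, smul_comm]
  refine ⟨_, fun t => e (eq t).1 (eq t).2, fun t => f (eq t).1, fun t => he _ _, fun t => hf _,
    ΨE.symm.trans Ω, ?_, ?_⟩
  · intro b m
    obtain ⟨x, rfl⟩ := ΨE.surjective m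
    funext t
    rw [hL]
    simp only [LinearEquiv.trans_apply, LinearEquiv.symm_apply_apply, hΩ]
    exact Theta_left k B _ _ _ _ (hΦ _) b _ _
  · intro b m
    obtain ⟨x, rfl⟩ := ΨE.surjective m
    funext t
    rw [hΨE, ← map_smul, ← hΨE, ← hΨE]
    simp only [LinearEquiv.trans_apply, LinearEquiv.symm_apply_apply, hΩ]
    exact Theta_right k B _ _ _ _ b _ _

end Stmt15
end
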